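/- arXiv:1807.01194 — 5 statements merged into one kernel-verified Lean document; each statement's English description precedes it below -/
import Mathlib

section
/- Let $A \in \mathbb{R}^{n\times d}$ with $n \le d$, let $b \in \mathbb{R}^n$, and let $K \subset \mathbb{R}^d$ be a compact set. If the set $C = \{x \in K : Ax < b \text{ componentwise}\}$ is non-empty, then $C \cap \partial K \neq \emptyset$, where $\partial K = \overline{K} \setminus K^{\circ}$ denotes the topological boundary of $K$. -/
/-- A matrix with at most as many rows as columns has a nonzero vector `v` with `A v ≤ 0`. -/
theorem Matrix.exists_ne_zero_mulVec_nonpos {n d : ℕ} (hd : 1 ≤ d) (hnd : n ≤ d)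
    (A : Matrix (Fin n) (Fin d) ℝ) : ∃ v ≠ 0, ∀ i, A.mulVec v i ≤ 0 := by
  by_cases hA : Function.Injective A.mulVecLin
  · have hdn : d ≤ n := by simpa using LinearMap.finrank_le_finrank_of_injective hA
    obtain rfl : n = d := le_antisymm hnd hdn
    obtain ⟨v, hv⟩ := LinearMap.injective_iff_surjective.mp hA (fun _ ↦ -1)
    have hv' (i : Fin n) : A.mulVec v i = -1 := congrFun hv i
    refine ⟨v, ?_, fun i ↦ by simp [hv']⟩
    rintro rfl
    simpa using hv' ⟨0, hd⟩
  · rw [injective_iff_map_eq_zero] at hA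
    push Not at hA
    obtain ⟨v, hv, hv0⟩ := hA
    exact ⟨v, hv0, fun i ↦ (congrFun hv i).le⟩

/-- A ray issuing from a point of a compact set meets the frontier of that set. -/
theorem IsCompact.exists_add_smul_mem_frontier {E : Type*} [NormedAddCommGroup E]
    [NormedSpace ℝ E] {K : Set E} (hK : IsCompact K) {x v : E} (hx : x ∈ K) (hv : v ≠ 0) :
    ∃ t : ℝ, 0 ≤ t ∧ x + t • v ∈ K ∧ x + t • v ∈ frontier K := by
  have hcont : Continuous fun t : ℝ ↦ x + t • v := by fun_prop
  let S : Set ℝ := {t | 0 ≤ t ∧ x + t • v ∈ K}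
  have hclosed : IsClosed S := isClosed_Ici.inter (hK.isClosed.preimage hcont)
  have hne : S.Nonempty := ⟨0, le_rfl, by simpa using hx⟩
  have hbdd : BddAbove S := by
    obtain ⟨R, hR⟩ := hK.isBounded.exists_norm_le
    refine ⟨(R + ‖x‖) / ‖v‖, fun t ht ↦ ?_⟩
    rw [le_div_iff₀ (norm_pos_iff.mpr hv)]
    calc t * ‖v‖ = ‖(x + t • v) - x‖ := by simp [norm_smul, abs_of_nonneg ht.1]
      _ ≤ ‖x + t • v‖ + ‖x‖ := norm_sub_le _ _
      _ ≤ R + ‖x‖ := by gcongr; exact hR _ ht.2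
  obtain ⟨h0, hmem⟩ := hclosed.csSup_mem hne hbdd
  refine ⟨sSup S, h0, hmem, subset_closure hmem, fun hint ↦ ?_⟩
  have hev : ∀ᶠ t in nhds (sSup S), x + t • v ∈ K :=
    hcont.continuousAt.eventually (mem_interior_iff_mem_nhds.mp hint)
  obtain ⟨t, ht, hlt⟩ := ((hev.filter_mono nhdsWithin_le_nhds).and
    (self_mem_nhdsWithin (s := Set.Ioi (sSup S)))).exists
  have hlt : sSup S < t := hlt
  exact (le_csSup hbdd ⟨h0.trans hlt.le, ht⟩).not_gt hlt


/-- If `A ∈ ℝ^{n×d}` with `n ≤ d`, `K ⊆ ℝ^d` is compact and the set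
`C = {x ∈ K : Ax < b componentwise}` is non-empty, then `C` meets the
topological boundary `∂K = closure K \ interior K` of `K`. -/
theorem open_polyhedron_meets_boundary
    (n d : ℕ) (hd : 1 ≤ d) (hnd : n ≤ d)
    (A : Matrix (Fin n) (Fin d) ℝ) (b : Fin n → ℝ)
    (K : Set (Fin d → ℝ)) (hK : IsCompact K)
    (C : Set (Fin d → ℝ)) (hC : C = {x ∈ K | ∀ i, A.mulVec x i < b i})
    (hne : C.Nonempty) :
    (C ∩ frontier K).Nonempty := by
  subst hC
  obtain ⟨x, hxK, hx⟩ := hne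
  obtain ⟨v, hv0, hv⟩ := A.exists_ne_zero_mulVec_nonpos hd hnd
  obtain ⟨t, ht, hmem, hfr⟩ := hK.exists_add_smul_mem_frontier hxK hv0
  refine ⟨x + t • v, ⟨hmem, fun i ↦ ?_⟩, hfr⟩
  have h := mul_nonpos_of_nonneg_of_nonpos ht (hv i)
  simp only [Matrix.mulVec_add, Matrix.mulVec_smul, Pi.add_apply, Pi.smul_apply, smul_eq_mul]
  linarith [hx i]
end

section
/- Let $\sigma: \mathbb{R} \to \mathbb{R}$ be continuous and let $F: \mathbb{R}^d \to \mathbb{R}^d$ be given by $F = A_L \circ \cdots \circ A_1$ where $A_j(x) = \sigma(W_j x + b_j)$ with $W_j \in \mathbb{R}^{d\times d}$, $b_j \in \mathbb{R}^d$, and $\sigma$ applied componentwise. Then for every compact set $K \subset \mathbb{R}^d$ and every $\varepsilon > 0$ there exist invertible matrices $\tilde{W}_1, \dots, \tilde{W}_L \in \mathbb{R}^{d\times d}$ such that the map $\tilde{F} = \tilde{A}_L \circ \cdots \circ \tilde{A}_1$ with $\tilde{A}_j(x) = \sigma(\tilde{W}_j x + b_j)$ satisfies $\lVert \tilde{F}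 - F \rVert_K < \varepsilon$. -/
/-- The Euclidean norm of a vector in `ℝ^d`. -/
noncomputable def euclNorm {d : ℕ} (v : Fin d → ℝ) : ℝ :=
  Real.sqrt (∑ i, v i ^ 2)

/-- The sup-norm `‖f‖_D = sup {‖f x‖ : x ∈ D}` of a vector-valued map over a set. -/
noncomputable def supNormOn {d : ℕ} (f : (Fin d → ℝ) → Fin d → ℝ)
    (D : Set (Fin d → ℝ)) : ℝ :=
  sSup {r | ∃ x ∈ D, r = euclNorm (f x)}

/-- The composition `A_j ∘ ⋯ ∘ A_1` of `j` square layers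
`A_k(x) = σ(W_k x + b_k)` (with `σ` applied componentwise);
layer `k` uses weight matrix `W (k-1)` and bias `b (k-1)`. -/
def sqStack (σ : ℝ → ℝ) {d : ℕ} (W : ℕ → Matrix (Fin d) (Fin d) ℝ)
    (b : ℕ → Fin d → ℝ) : ℕ → (Fin d → ℝ) → Fin d → ℝ
  | 0, x => x
  | j + 1, x => fun i => σ ((W j).mulVec (sqStack σ W b j x) i + b j i)

open Filter Topology

theorem continuous_euclNorm {d : ℕ} : Continuous (euclNorm : (Fin d → ℝ) → ℝ) := by
  unfold euclNorm
  fun_prop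

theorem euclNorm_zero {d : ℕ} : euclNorm (0 : Fin d → ℝ) = 0 := by
  simp [euclNorm]

/-- A network depends jointly continuously on a parameter of its weights and on its input. -/
theorem continuous_sqStack {T : Type*} [TopologicalSpace T] {σ : ℝ → ℝ} (hσ : Continuous σ)
    {d : ℕ} {W : T → ℕ → Matrix (Fin d) (Fin d) ℝ} (hW : ∀ j, Continuous fun t => W t j)
    (b : ℕ → Fin d → ℝ) (j : ℕ) :
    Continuous fun p : T × (Fin d → ℝ) => sqStack σ (W p.1) b j p.2 := by
  induction j with
  | zero => exact continuous_snd
  | succ j ih =>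
    refine continuous_pi fun i => hσ.comp (Continuous.add ?_ continuous_const)
    exact (continuous_apply i).comp (((hW j).comp continuous_fst).matrix_mulVec ih)

theorem eventually_isUnit_det_add_scalar {d : ℕ} (M : Matrix (Fin d) (Fin d) ℝ) :
    ∀ᶠ t : ℝ in 𝓝[≠] 0, IsUnit (M + Matrix.scalar (Fin d) t).det := by
  have hfin : {t : ℝ | (-M).charpoly.IsRoot t}.Finite :=
    Polynomial.finite_setOfPred_isRoot (-M).charpoly_monic.ne_zero
  have hev : ∀ᶠ t : ℝ in 𝓝[≠] 0, t ∉ {t : ℝ | (-M).charpoly.IsRoot t} :=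
    nhdsNE_le_cofinite 0 hfin.compl_mem_cofinite
  filter_upwards [hev] with t ht
  rw [isUnit_iff_ne_zero]
  intro h
  apply ht
  rw [Polynomial.IsRoot, Matrix.eval_charpoly, sub_neg_eq_add, add_comm, h]

/-- Lemma 4: a network `F = A_L ∘ ⋯ ∘ A_1` of square layers with continuous
activation `σ` can be approximated uniformly on any compact `K`, to any
accuracy `ε > 0`, by a network `F̃` of the same architecture (same biases)
whose weight matrices are all invertible. -/
theorem approx_network_by_invertible_weights
    (σ : ℝ → ℝ) (hσ : Continuous σ)
    (d L : ℕ) (hL : 1 ≤ L)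
    (W : ℕ → Matrix (Fin d) (Fin d) ℝ) (b : ℕ → Fin d → ℝ)
    (F : (Fin d → ℝ) → Fin d → ℝ) (hF : ∀ x, F x = sqStack σ W b L x)
    (K : Set (Fin d → ℝ)) (hK : IsCompact K)
    (ε : ℝ) (hε : 0 < ε) :
    ∃ Wt : ℕ → Matrix (Fin d) (Fin d) ℝ,
      (∀ j < L, IsUnit (Wt j).det) ∧
      supNormOn (fun x => sqStack σ Wt b L x - F x) K < ε := by
  let V : ℝ → ℕ → Matrix (Fin d) (Fin d) ℝ := fun t j => W j + Matrix.scalar (Fin d) t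
  have hV : ∀ j, Continuous fun t => V t j := fun j => by
    simp only [V, Matrix.scalar_apply]
    fun_prop
  have hV0 : V 0 = W := by simp [V]
  have hinv : ∀ᶠ t : ℝ in 𝓝[≠] 0, ∀ j ∈ Finset.range L, IsUnit (V t j).det :=
    (Filter.eventually_all_finset _).2 fun j _ => eventually_isUnit_det_add_scalar (W j)
  have hcont : Continuous fun p : ℝ × (Fin d → ℝ) =>
      euclNorm (sqStack σ (V p.1) b L p.2 - sqStack σ W b L p.2) :=
    continuous_euclNorm.comp ((continuous_sqStack hσ hV b L).sub
      ((continuous_sqStack (W := fun _ : ℝ => W) hσ (fun _ => continuous_const) b L)))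
  have happrox : ∀ᶠ t : ℝ in 𝓝 0, ∀ x ∈ K,
      euclNorm (sqStack σ (V t) b L x - sqStack σ W b L x) < ε / 2 := by
    refine hK.eventually_forall_of_forall_eventually fun x _ => ?_
    refine hcont.continuousAt.eventually_lt_const ?_
    simp only [hV0, sub_self, euclNorm_zero]
    exact half_pos hε
  obtain ⟨t, hdet, hlt⟩ := (hinv.and (happrox.filter_mono nhdsWithin_le_nhds)).exists
  refine ⟨V t, fun j hj => hdet j (Finset.mem_range.2 hj), ?_⟩
  refine lt_of_le_of_lt (Real.sSup_le ?_ (half_pos hε).le) (half_lt_self hε)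
  rintro r ⟨x, hx, rfl⟩
  simp only [hF]
  exact (hlt x hx).le
end

section
/- Let $\sigma: \mathbb{R} \to \mathbb{R}$ be continuous and strictly monotonic, and let $F: \mathbb{R}^{d_{in}} \to \mathbb{R}^{d_{out}}$ be a neural network function with activation $\sigma$ and width $\omega_F \le d_{in}$. Then for every class $j \in \{1, \dots, d_{out}\}$, every non-empty connected component of the decision region $C_j = \{x \in \mathbb{R}^{d_{in}} : F_j(x) > F_k(x) \text{ for all } k \neq j\}$ is unbounded. -/
/-- The composition `A_j ∘ ⋯ ∘ A_1` of the first `j` layers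
`A_k(x) = σ(W_k x + b_k)` of a network with layer widths `d 0, d 1, …`
(`σ` applied componentwise); layer `k` uses `W (k-1)` and `b (k-1)`. -/
def hiddenStack (σ : ℝ → ℝ) (d : ℕ → ℕ)
    (W : (j : ℕ) → Matrix (Fin (d (j + 1))) (Fin (d j)) ℝ)
    (b : (j : ℕ) → Fin (d (j + 1)) → ℝ) :
    (j : ℕ) → (Fin (d 0) → ℝ) → Fin (d j) → ℝ
  | 0, x => x
  | j + 1, x => fun i => σ ((W j).mulVec (hiddenStack σ d W b j x) i + b j i)

/-- Every connected component of `V` is unbounded. -/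
def ComponentsUnbounded {X : Type*} [PseudoMetricSpace X] (V : Set X) : Prop :=
  ∀ x ∈ V, ¬ Bornology.IsBounded (connectedComponentIn V x)

/-- A set containing a ray from `x` has an unbounded component at `x`. -/
theorem not_isBounded_connectedComponentIn_of_ray {E : Type*} [NormedAddCommGroup E]
    [NormedSpace ℝ E] {V : Set E} {x v : E} (hv : v ≠ 0)
    (hray : ∀ t : ℝ, 0 ≤ t → x + t • v ∈ V) :
    ¬ Bornology.IsBounded (connectedComponentIn V x) := by
  intro hb
  have hsub : (fun t : ℝ => x + t • v) '' Set.Ici 0 ⊆ connectedComponentIn V x := by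
    refine IsPreconnected.subset_connectedComponentIn ?_ ⟨0, by simp, by simp⟩ ?_
    · exact isPreconnected_Ici.image _ (by fun_prop)
    · rintro _ ⟨t, ht, rfl⟩
      exact hray t ht
  obtain ⟨R, hR⟩ := (hb.subset hsub).exists_norm_le
  have hv' : 0 < ‖v‖ := norm_pos_iff.mpr hv
  have ht : 0 ≤ (|R| + ‖x‖ + 1) / ‖v‖ := by positivity
  have h := hR _ ⟨_, ht, rfl⟩
  have h2 : ‖((|R| + ‖x‖ + 1) / ‖v‖) • v‖ = |R| + ‖x‖ + 1 := by
    rw [norm_smul, Real.norm_of_nonneg ht, div_mul_cancel₀ _ hv'.ne']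
  have h3 := norm_sub_le (x + ((|R| + ‖x‖ + 1) / ‖v‖) • v) x
  rw [add_sub_cancel_left, h2] at h3
  dsimp only at h
  linarith [le_abs_self R]

/-- Preimages under continuous open maps of open sets with unbounded components
have unbounded components. -/
theorem ComponentsUnbounded.preimage {X Y : Type*} [MetricSpace X] [ProperSpace X]
    [LocallyConnectedSpace X] [MetricSpace Y] {G : X → Y} (hc : Continuous G)
    (ho : IsOpenMap G) {V : Set Y} (hV : IsOpen V) (h : ComponentsUnbounded V) :
    ComponentsUnbounded (G ⁻¹' V) := by
  intro x hx hb
  set K := connectedComponentIn (G ⁻¹' V) x with hK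
  have hKV : K ⊆ G ⁻¹' V := connectedComponentIn_subset _ _
  have hxK : x ∈ K := mem_connectedComponentIn hx
  have hKo : IsOpen K := (hV.preimage hc).connectedComponentIn
  have hclosed : closure K ∩ G ⁻¹' V ⊆ K :=
    (isPreconnected_connectedComponentIn.subset_closure
      (Set.subset_inter subset_closure hKV) Set.inter_subset_left).subset_connectedComponentIn
      ⟨subset_closure hxK, hx⟩ Set.inter_subset_right
  have hcomp : IsCompact (G '' closure K) := hb.isCompact_closure.image hc
  have hsub : connectedComponentIn V (G x) ⊆ G '' K := by
    refine isPreconnected_connectedComponentIn.subset_of_closure_inter_subset (ho _ hKo)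
      ⟨G x, mem_connectedComponentIn hx, Set.mem_image_of_mem _ hxK⟩ ?_
    rintro y ⟨hy, hyT⟩
    obtain ⟨z, hz, rfl⟩ :=
      closure_minimal (Set.image_mono subset_closure) hcomp.isClosed hy
    exact ⟨z, hclosed ⟨hz, connectedComponentIn_subset V _ hyT⟩, rfl⟩
  exact h (G x) hx
    (hcomp.isBounded.subset (hsub.trans (Set.image_mono subset_closure)))

theorem isOpenMap_of_strictMono_or_strictAnti {σ : ℝ → ℝ} (hc : Continuous σ)
    (hm : StrictMono σ ∨ StrictAnti σ) : IsOpenMap σ := by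
  rw [isOpenMap_iff_nhds_le]
  intro x s hs
  obtain ⟨ε, hε, hsub⟩ := Metric.mem_nhds_iff.mp (Filter.mem_map.mp hs)
  rw [Real.ball_eq_Ioo] at hsub
  have hle : x - ε ≤ x + ε := by linarith
  have himg : σ '' Set.Ioo (x - ε) (x + ε) ⊆ s := Set.image_subset_iff.mpr hsub
  rcases hm with hm | hm
  · exact Filter.mem_of_superset
      (Ioo_mem_nhds (hm (by linarith)) (hm (by linarith)))
      ((intermediate_value_Ioo hle hc.continuousOn).trans himg)
  · exact Filter.mem_of_superset
      (Ioo_mem_nhds (hm (by linarith)) (hm (by linarith)))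
      ((intermediate_value_Ioo' hle hc.continuousOn).trans himg)

/-- If `A` is not injective, preimages under maps factoring through `A` have
unbounded components. -/
theorem componentsUnbounded_preimage_of_not_injective {m n : ℕ}
    (A : Matrix (Fin m) (Fin n) ℝ) (hA : ¬ Function.Injective A.mulVec) {Y : Type*}
    (g : (Fin m → ℝ) → Y) (V : Set Y) :
    ComponentsUnbounded ((fun x => g (A.mulVec x)) ⁻¹' V) := by
  intro x hx
  obtain ⟨y, z, hyz, hne⟩ : ∃ y z, A.mulVec y = A.mulVec z ∧ y ≠ z := by
    simpa [Function.Injective] using hA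
  refine not_isBounded_connectedComponentIn_of_ray (sub_ne_zero.mpr hne) fun t _ => ?_
  simpa [Matrix.mulVec_add, Matrix.mulVec_smul, Matrix.mulVec_sub, hyz] using hx

theorem surjective_mulVec_of_injective {m n : ℕ} (hmn : m ≤ n)
    (A : Matrix (Fin m) (Fin n) ℝ) (hA : Function.Injective A.mulVec) :
    m = n ∧ Function.Surjective A.mulVec := by
  have hinj : Function.Injective A.mulVecLin := hA
  have hle := LinearMap.finrank_le_finrank_of_injective hinj
  simp only [Module.finrank_fin_fun] at hle
  have heq : m = n := le_antisymm hmn hle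
  exact ⟨heq, (LinearMap.injective_iff_surjective_of_finrank_eq_finrank
    (by simp [heq])).mp hinj⟩

theorem isOpenMap_mulVec_of_surjective {m n : ℕ} (A : Matrix (Fin m) (Fin n) ℝ)
    (hA : Function.Surjective A.mulVec) : IsOpenMap A.mulVec :=
  (LinearMap.toContinuousLinearMap A.mulVecLin).isOpenMap hA

/-- Either `G` is an open map between spaces of equal dimension, or all preimages of
open sets under `G` have unbounded components. -/
def OpenOrDegenerate {n m : ℕ} (G : (Fin n → ℝ) → Fin m → ℝ) : Prop :=
  (m = n ∧ IsOpenMap G) ∨ ∀ V, IsOpen V → ComponentsUnbounded (G ⁻¹' V)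

/-- Composition with a layer `x ↦ g (A x)`, where `g` is continuous and open, preserves
`OpenOrDegenerate` as long as the width does not exceed the input dimension. -/
theorem OpenOrDegenerate.comp_layer {n m k : ℕ} {G : (Fin n → ℝ) → Fin m → ℝ}
    (hG : OpenOrDegenerate G) (hGc : Continuous G) (A : Matrix (Fin k) (Fin m) ℝ)
    (hk : k ≤ n) {g : (Fin k → ℝ) → Fin k → ℝ} (hg : Continuous g) (hgo : IsOpenMap g) :
    OpenOrDegenerate fun x => g (A.mulVec (G x)) := by
  have hAc : Continuous fun y => g (A.mulVec y) := by fun_prop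
  rcases hG with ⟨hm, hGo⟩ | hG
  · by_cases hA : Function.Injective A.mulVec
    · obtain ⟨hkm, hs⟩ := surjective_mulVec_of_injective (hm ▸ hk) A hA
      exact Or.inl ⟨hkm.trans hm,
        hgo.comp ((isOpenMap_mulVec_of_surjective A hs).comp hGo)⟩
    · exact Or.inr fun V hV => (componentsUnbounded_preimage_of_not_injective A hA g V).preimage
        hGc hGo (hV.preimage hAc)
  · exact Or.inr fun V hV => hG _ (hV.preimage hAc)

theorem continuous_hiddenStack {σ : ℝ → ℝ} (hσ : Continuous σ) (d : ℕ → ℕ)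
    (W : (j : ℕ) → Matrix (Fin (d (j + 1))) (Fin (d j)) ℝ)
    (b : (j : ℕ) → Fin (d (j + 1)) → ℝ) (j : ℕ) :
    Continuous (hiddenStack σ d W b j) := by
  induction j with
  | zero => exact continuous_id
  | succ j ih =>
    have h : Continuous fun x => (W j).mulVec (hiddenStack σ d W b j x) := by fun_prop
    exact continuous_pi fun i =>
      hσ.comp (((continuous_apply i).comp h).add continuous_const)

theorem openOrDegenerate_hiddenStack {σ : ℝ → ℝ} (hσ : Continuous σ) (hσo : IsOpenMap σ)
    (d : ℕ → ℕ) (W : (j : ℕ) → Matrix (Fin (d (j + 1))) (Fin (d j)) ℝ)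
    (b : (j : ℕ) → Fin (d (j + 1)) → ℝ) (j : ℕ)
    (hwidth : ∀ i, 1 ≤ i → i ≤ j → d i ≤ d 0) :
    OpenOrDegenerate (hiddenStack σ d W b j) := by
  induction j with
  | zero => exact Or.inl ⟨rfl, IsOpenMap.id⟩
  | succ j ih =>
    have hg : IsOpenMap fun (y : Fin (d (j + 1)) → ℝ) i => σ ((y + b j) i) :=
      (IsOpenMap.piMap (fun _ => hσo) (by simp)).comp (isOpenMap_add_right (b j))
    exact (ih fun i h1 h2 => hwidth i h1 (by omega)).comp_layer
      (continuous_hiddenStack hσ d W b j) (W j) (hwidth _ (by omega) le_rfl)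
      (by fun_prop) hg

theorem isOpen_setOf_forall_lt_apply {ι : Type*} [Finite ι] (j : ι) :
    IsOpen {y : ι → ℝ | ∀ k, k ≠ j → y k < y j} := by
  simp only [Set.ofPred_forall]
  exact isOpen_iInter_of_finite fun k => isOpen_iInter_of_finite fun _ =>
    isOpen_lt (continuous_apply k) (continuous_apply j)

theorem componentsUnbounded_setOf_forall_lt_apply {ι : Type*} [Fintype ι] [DecidableEq ι]
    (j : ι) : ComponentsUnbounded {y : ι → ℝ | ∀ k, k ≠ j → y k < y j} := by
  intro y hy
  refine not_isBounded_connectedComponentIn_of_ray (v := Pi.single j 1) (by simp)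
    fun t ht k hk => ?_
  have := hy k hk
  simp only [Pi.add_apply, Pi.smul_apply, Pi.single_eq_of_ne hk, Pi.single_eq_same, smul_eq_mul]
  linarith

theorem abs_apply_le_euclNorm {d : ℕ} (v : Fin d → ℝ) (i : Fin d) : |v i| ≤ euclNorm v :=
  Real.abs_le_sqrt
    (Finset.single_le_sum (f := fun i => v i ^ 2) (fun i _ => sq_nonneg (v i)) (Finset.mem_univ i))

/-- Main theorem (continuous strictly monotonic activation): for a network
function `F(x) = W_L(A_{L-1} ∘ ⋯ ∘ A_1(x)) + b_L` of depth `L+1` whose width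
`max {d j : 1 ≤ j ≤ L+1}` does not exceed the input dimension `d 0`, every
non-empty connected component of a decision region
`C_j = {x : F_j(x) > F_k(x) ∀ k ≠ j}` is unbounded. -/
theorem decision_region_components_unbounded_monotone
    (σ : ℝ → ℝ) (hσc : Continuous σ) (hσm : StrictMono σ ∨ StrictAnti σ)
    (d : ℕ → ℕ) (L : ℕ)
    (W : (j : ℕ) → Matrix (Fin (d (j + 1))) (Fin (d j)) ℝ)
    (b : (j : ℕ) → Fin (d (j + 1)) → ℝ)
    (hwidth : ∀ j, 1 ≤ j → j ≤ L + 1 → d j ≤ d 0)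
    (F : (Fin (d 0) → ℝ) → Fin (d (L + 1)) → ℝ)
    (hF : ∀ x, F x = (W L).mulVec (hiddenStack σ d W b L x) + b L)
    (j : Fin (d (L + 1)))
    (Cj : Set (Fin (d 0) → ℝ))
    (hCj : Cj = {x | ∀ k, k ≠ j → F x k < F x j})
    (x₀ : Fin (d 0) → ℝ) (hx₀ : x₀ ∈ Cj) :
    ¬ ∃ R : ℝ, ∀ x ∈ connectedComponentIn Cj x₀, euclNorm x ≤ R := by
  rintro ⟨R, hR⟩
  have hF' : F = fun x => (W L).mulVec (hiddenStack σ d W b L x) + b L := funext hF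
  have hstack := openOrDegenerate_hiddenStack hσc
    (isOpenMap_of_strictMono_or_strictAnti hσc hσm) d W b L
    fun i h1 h2 => hwidth i h1 (by omega)
  have hstackc := continuous_hiddenStack hσc d W b L
  have hFc : Continuous F := by rw [hF']; fun_prop
  have hFd : OpenOrDegenerate F := by
    rw [hF']
    exact hstack.comp_layer hstackc (W L) (hwidth _ (by omega) le_rfl)
      (continuous_id.add continuous_const) (isOpenMap_add_right (b L))
  have hunb : ComponentsUnbounded Cj := by
    rw [hCj]
    rcases hFd with ⟨-, ho⟩ | h
    · exact (componentsUnbounded_setOf_forall_lt_apply j).preimage hFc ho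
        (isOpen_setOf_forall_lt_apply j)
    · exact h _ (isOpen_setOf_forall_lt_apply j)
  refine hunb x₀ hx₀ (isBounded_iff_forall_norm_le.mpr ⟨R, fun x hx => ?_⟩)
  exact (pi_norm_le_iff_of_nonneg ((Real.sqrt_nonneg _).trans (hR x hx))).mpr
    fun i => (abs_apply_le_euclNorm x i).trans (hR x hx)
end

section
/- Let $\sigma$ be the ReLU activation $\sigma(t) = \max\{t, 0\}$ and let $F: \mathbb{R}^{d_{in}} \to \mathbb{R}^{d_{out}}$ be a neural network function with activation $\sigma$ and width $\omega_F \le d_{in}$. Then for every class $j \in \{1, \dots, d_{out}\}$, every non-empty connected component of the decision region $C_j = \{x \in \mathbb{R}^{d_{in}} : F_j(x) > F_k(x) \text{ for all } k \neq j\}$ is unbounded. -/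
section

open Set Filter Topology

/-- The continuous self-maps of `X` that are limits, in the compact-open topology, of
self-homeomorphisms of `X`. -/
def homeomorphClosure (X : Type*) [TopologicalSpace X] : Set C(X, X) :=
  closure (range fun h : X ≃ₜ X => (h : C(X, X)))

theorem id_mem_homeomorphClosure (X : Type*) [TopologicalSpace X] :
    ContinuousMap.id X ∈ homeomorphClosure X :=
  subset_closure ⟨Homeomorph.refl X, rfl⟩

theorem comp_mem_homeomorphClosure {X : Type*} [TopologicalSpace X] [LocallyCompactSpace X]
    {f g : C(X, X)} (hf : f ∈ homeomorphClosure X) (hg : g ∈ homeomorphClosure X) :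
    f.comp g ∈ homeomorphClosure X := by
  refine map_mem_closure₂ (f := fun f g : C(X, X) => f.comp g)
    (ContinuousMap.continuous_comp'.comp continuous_swap) hf hg ?_
  rintro _ ⟨h, rfl⟩ _ ⟨k, rfl⟩
  exact ⟨k.trans h, rfl⟩

theorem mem_homeomorphClosure_of_family {X : Type*} [TopologicalSpace X] (H : C(ℝ × X, X))
    (hH : ∃ᶠ t in 𝓝 (0 : ℝ), ∃ h : X ≃ₜ X, ∀ x, h x = H (t, x)) (f : C(X, X))
    (hf : ∀ x, f x = H (0, x)) : f ∈ homeomorphClosure X := by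
  have hf' : f = H.curry 0 := ContinuousMap.ext hf
  rw [hf']
  refine mem_closure_of_frequently_of_tendsto ?_ (H.curry.continuous.tendsto 0)
  refine hH.mono fun t ⟨h, hh⟩ => ⟨h, ContinuousMap.ext hh⟩

/-- The leaky ReLU of slope `t > 0` on the negative half-line, as a homeomorphism. -/
noncomputable def leakyReLUHomeomorph (t : ℝ) (ht : 0 < t) : ℝ ≃ₜ ℝ where
  toFun u := max u 0 + t * min u 0
  invFun u := max u 0 + t⁻¹ * min u 0
  left_inv u := by
    rcases le_total 0 u with hu | hu
    · simp [hu]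
    · have : t * u ≤ 0 := mul_nonpos_of_nonneg_of_nonpos ht.le hu
      simp [hu, this, ht.ne']
  right_inv u := by
    rcases le_total 0 u with hu | hu
    · simp [hu]
    · have : t⁻¹ * u ≤ 0 := mul_nonpos_of_nonneg_of_nonpos (inv_pos.2 ht).le hu
      simp [hu, this, ht.ne']
  continuous_toFun := by fun_prop
  continuous_invFun := by fun_prop

theorem relu_mem_homeomorphClosure {ι : Type*} (f : C(ι → ℝ, ι → ℝ))
    (hf : ∀ x i, f x i = max (x i) 0) : f ∈ homeomorphClosure (ι → ℝ) := by
  refine mem_homeomorphClosure_of_family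
    ⟨fun p : ℝ × (ι → ℝ) => fun i => max (p.2 i) 0 + p.1 * min (p.2 i) 0, by fun_prop⟩ ?_ f ?_
  · have hpos : ∀ᶠ t : ℝ in 𝓝[>] 0, 0 < t := eventually_mem_nhdsWithin
    refine (hpos.frequently.filter_mono nhdsWithin_le_nhds).mono fun t ht => ?_
    exact ⟨Homeomorph.piCongrRight fun _ => leakyReLUHomeomorph t ht, fun x => rfl⟩
  · intro x
    ext i
    simp [hf]

theorem eventually_isUnit_add_smul_id {E : Type*} [AddCommGroup E] [Module ℝ E]
    [FiniteDimensional ℝ E] (A : E →ₗ[ℝ] E) :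
    ∀ᶠ t : ℝ in 𝓝[≠] 0, IsUnit (A + t • LinearMap.id) := by
  have hfin : (spectrum ℝ (-A : Module.End ℝ E)).Finite := Module.End.finite_spectrum _
  have hev : ∀ᶠ t : ℝ in 𝓝[≠] 0, t ∉ spectrum ℝ (-A : Module.End ℝ E) := by
    have := (hfin.subset (sdiff_subset (t := {(0 : ℝ)}))).isClosed.isOpen_compl.mem_nhds
      (x := (0 : ℝ)) (by simp)
    filter_upwards [nhdsWithin_le_nhds this, self_mem_nhdsWithin] with t ht ht0 hmem
    exact ht ⟨hmem, ht0⟩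
  refine hev.mono fun t ht => ?_
  rw [spectrum.notMem_iff, sub_neg_eq_add, add_comm, Algebra.algebraMap_eq_smul_one] at ht
  exact ht

theorem affine_mem_homeomorphClosure {E : Type*} [NormedAddCommGroup E] [NormedSpace ℝ E]
    [FiniteDimensional ℝ E] (A : E →ₗ[ℝ] E) (c : E) (f : C(E, E))
    (hf : ∀ x, f x = A x + c) : f ∈ homeomorphClosure E := by
  have hA : Continuous A := A.continuous_of_finiteDimensional
  refine mem_homeomorphClosure_of_family ⟨fun p => A p.2 + p.1 • p.2 + c, by fun_prop⟩ ?_ f ?_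
  · refine ((eventually_isUnit_add_smul_id A).frequently.filter_mono nhdsWithin_le_nhds).mono
      fun t ht => ?_
    obtain ⟨u, hu⟩ := ht
    let e := LinearMap.GeneralLinearGroup.toLinearEquiv u
    refine ⟨e.toContinuousLinearEquiv.toHomeomorph.trans
      (Homeomorph.addRight c), fun x => ?_⟩
    have : (u : E →ₗ[ℝ] E) x = A x + t • x := by rw [hu]; rfl
    simpa [e] using this
  · intro x
    simp [hf]

theorem exists_layer_mem_homeomorphClosure {m k n : ℕ} (hm : m ≤ n) (hk : k ≤ n)
    (M : Matrix (Fin m) (Fin k) ℝ) (c : Fin m → ℝ) :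
    ∃ f ∈ homeomorphClosure (Fin n → ℝ), ∀ x i,
      f x (Fin.castLE hm i) = M.mulVec (fun q => x (Fin.castLE hk q)) i + c i := by
  let A : (Fin n → ℝ) →ₗ[ℝ] (Fin n → ℝ) :=
    Function.ExtendByZero.linearMap ℝ (Fin.castLE hm) ∘ₗ M.mulVecLin ∘ₗ
      LinearMap.funLeft ℝ ℝ (Fin.castLE hk)
  let c' : Fin n → ℝ := Function.extend (Fin.castLE hm) c 0
  have hA : Continuous A := A.continuous_of_finiteDimensional
  refine ⟨⟨fun x => A x + c', by fun_prop⟩, affine_mem_homeomorphClosure A c' _ fun _ => rfl,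
    fun x i => ?_⟩
  have hinj : Function.Injective (Fin.castLE hm) := Fin.castLE_injective hm
  simp only [ContinuousMap.coe_mk, Pi.add_apply, A, c', LinearMap.comp_apply,
    Function.ExtendByZero.linearMap_apply, hinj.extend_apply]
  rfl

theorem exists_hiddenStack_extension (σ : ℝ → ℝ) (hσ : ∀ t, σ t = max t 0)
    (d : ℕ → ℕ) (W : (j : ℕ) → Matrix (Fin (d (j + 1))) (Fin (d j)) ℝ)
    (b : (j : ℕ) → Fin (d (j + 1)) → ℝ) (l : ℕ) (hd : ∀ j ≤ l, d j ≤ d 0) :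
    ∃ f ∈ homeomorphClosure (Fin (d 0) → ℝ), ∀ x i,
      f x (Fin.castLE (hd l le_rfl) i) = hiddenStack σ d W b l x i := by
  induction l with
  | zero => exact ⟨_, id_mem_homeomorphClosure _, fun _ _ => rfl⟩
  | succ l ih =>
    obtain ⟨f, hf, hfx⟩ := ih fun j hj => hd j (by omega)
    obtain ⟨g, hg, hgx⟩ := exists_layer_mem_homeomorphClosure (hd (l + 1) le_rfl)
      (hd l (by omega)) (W l) (b l)
    let r : C(Fin (d 0) → ℝ, Fin (d 0) → ℝ) := ⟨fun x i => max (x i) 0, by fun_prop⟩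
    refine ⟨r.comp (g.comp f), comp_mem_homeomorphClosure
      (relu_mem_homeomorphClosure r fun _ _ => rfl) (comp_mem_homeomorphClosure hg hf),
      fun x i => ?_⟩
    simp [r, hiddenStack, hσ, hgx, hfx]

theorem disjoint_frontier_connectedComponentIn {X : Type*} [TopologicalSpace X]
    [LocallyConnectedSpace X] {U : Set X} (hU : IsOpen U) (x : X) :
    Disjoint (frontier (connectedComponentIn U x)) U := by
  rw [Set.disjoint_left]
  intro z hz hzU
  obtain ⟨y, hyz, hyx⟩ := mem_closure_iff.1 hz.1 _ (hU.connectedComponentIn (x := z))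
    (mem_connectedComponentIn hzU)
  have hzx : z ∈ connectedComponentIn U x := by
    rw [connectedComponentIn_eq hyx, ← connectedComponentIn_eq hyz]
    exact mem_connectedComponentIn hzU
  exact (hU.connectedComponentIn (x := x)).inter_frontier_eq.le ⟨hzx, hz⟩

/-- A homeomorphism pulls the ray from `h x` in direction `e i` back to a curve that
leaves every bounded set containing `x`. -/
theorem exists_frontier_add_single {n : ℕ} (h : (Fin n → ℝ) ≃ₜ (Fin n → ℝ)) (i : Fin n)
    {K : Set (Fin n → ℝ)} (hK : Bornology.IsBounded K) {x : Fin n → ℝ} (hx : x ∈ K) :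
    ∃ z ∈ frontier K, ∃ t : ℝ, 0 ≤ t ∧ h z = h x + Pi.single i t := by
  let γ : ℝ → Fin n → ℝ := fun t => h.symm (h x + Pi.single i t)
  have hγ : Continuous γ := by
    have : Continuous fun t : ℝ => (Pi.single i t : Fin n → ℝ) :=
      continuous_single (A := fun _ : Fin n => ℝ) i
    fun_prop
  obtain ⟨B, hB⟩ := (hK.isCompact_closure.image h.continuous).isBounded.exists_norm_le
  have hne : (γ '' Ici 0 ∩ Kᶜ).Nonempty := by
    have hB0 : 0 ≤ B := (norm_nonneg _).trans (hB _ ⟨x, subset_closure hx, rfl⟩)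
    refine ⟨γ (2 * B + 1), ⟨_, by simp only [mem_Ici]; linarith, rfl⟩, fun hmem => ?_⟩
    have h1 := (norm_le_pi_norm _ i).trans (hB _ ⟨_, subset_closure hmem, rfl⟩)
    have h2 := (norm_le_pi_norm _ i).trans (hB _ ⟨x, subset_closure hx, rfl⟩)
    simp only [γ, h.apply_symm_apply, Pi.add_apply, Pi.single_eq_same, Real.norm_eq_abs] at h1 h2
    linarith [le_abs_self (h x i + (2 * B + 1)), neg_abs_le (h x i)]
  have hconn : IsPreconnected (γ '' Ici 0) := isPreconnected_Ici.image _ hγ.continuousOn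
  have hin : (γ '' Ici 0 ∩ K).Nonempty := ⟨x, ⟨0, by simp, by simp [γ]⟩, hx⟩
  have hfr : (γ '' Ici 0 ∩ frontier K).Nonempty := by
    by_contra hcon
    have hnot : ∀ y ∈ γ '' Ici 0, y ∈ closure K → y ∈ interior K := fun y hy hyc => by
      by_contra hyi
      exact hcon ⟨y, hy, hyc, hyi⟩
    obtain ⟨y, hy, hyK⟩ := hne
    obtain ⟨w, hw, hwK⟩ := hin
    obtain ⟨v, -, hv, hv'⟩ := hconn (interior K) (closure K)ᶜ isOpen_interior
      isClosed_closure.isOpen_compl (fun y hy => (em (y ∈ closure K)).imp (hnot y hy) id)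
      ⟨w, hw, hnot w hw (subset_closure hwK)⟩
      ⟨y, hy, fun hyc => hyK (interior_subset (hnot y hy hyc))⟩
    exact hv' (subset_closure (interior_subset hv))
  obtain ⟨_, ⟨t, ht, rfl⟩, hz⟩ := hfr
  exact ⟨γ t, hz, t, ht, by simp [γ]⟩

theorem isBounded_of_euclNorm_le {n : ℕ} {K : Set (Fin n → ℝ)} {R : ℝ}
    (hR : ∀ x ∈ K, euclNorm x ≤ R) : Bornology.IsBounded K := by
  refine isBounded_iff_forall_norm_le.2 ⟨R, fun x hx => le_trans ?_ (hR x hx)⟩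
  refine (pi_norm_le_iff_of_nonneg (Real.sqrt_nonneg _)).2 fun i => ?_
  exact Real.abs_le_sqrt
    (Finset.single_le_sum (f := fun i => x i ^ 2) (fun _ _ => sq_nonneg _) (Finset.mem_univ i))


end

/-- Main theorem (ReLU activation `σ(t) = max {t, 0}`): for a network
function `F(x) = W_L(A_{L-1} ∘ ⋯ ∘ A_1(x)) + b_L` of depth `L+1` whose width
`max {d j : 1 ≤ j ≤ L+1}` does not exceed the input dimension `d 0`, every
non-empty connected component of a decision region
`C_j = {x : F_j(x) > F_k(x) ∀ k ≠ j}` is unbounded. -/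
theorem decision_region_components_unbounded_relu
    (σ : ℝ → ℝ) (hσ : ∀ t, σ t = max t 0)
    (d : ℕ → ℕ) (L : ℕ)
    (W : (j : ℕ) → Matrix (Fin (d (j + 1))) (Fin (d j)) ℝ)
    (b : (j : ℕ) → Fin (d (j + 1)) → ℝ)
    (hwidth : ∀ j, 1 ≤ j → j ≤ L + 1 → d j ≤ d 0)
    (F : (Fin (d 0) → ℝ) → Fin (d (L + 1)) → ℝ)
    (hF : ∀ x, F x = (W L).mulVec (hiddenStack σ d W b L x) + b L)
    (j : Fin (d (L + 1)))
    (Cj : Set (Fin (d 0) → ℝ))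
    (hCj : Cj = {x | ∀ k, k ≠ j → F x k < F x j})
    (x₀ : Fin (d 0) → ℝ) (hx₀ : x₀ ∈ Cj) :
    ¬ ∃ R : ℝ, ∀ x ∈ connectedComponentIn Cj x₀, euclNorm x ≤ R := by
  rintro ⟨R, hR⟩
  have hd : ∀ l ≤ L + 1, d l ≤ d 0 := fun l hl => by
    rcases Nat.eq_zero_or_pos l with rfl | hl0
    · exact le_rfl
    · exact hwidth l hl0 hl
  obtain ⟨f, hf, hfx⟩ := exists_hiddenStack_extension σ hσ d W b L fun l hl => hd l (by omega)
  obtain ⟨g, hg, hgx⟩ := exists_layer_mem_homeomorphClosure (hd (L + 1) le_rfl)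
    (hd L (by omega)) (W L) (b L)
  have hG : g.comp f ∈ homeomorphClosure (Fin (d 0) → ℝ) := comp_mem_homeomorphClosure hg hf
  have hGF : ∀ x i, F x i = g.comp f x (Fin.castLE (hd (L + 1) le_rfl) i) := fun x i => by
    simp [hF, hgx, hfx]
  generalize g.comp f = G at hG hGF
  have hopen : IsOpen Cj := by
    have hFc : ∀ i, Continuous fun x => F x i := fun i => by
      simp only [hGF]
      fun_prop
    simp only [hCj, Set.ofPred_forall]
    exact isOpen_iInter_of_finite fun k => isOpen_iInter_of_finite fun _ =>
      isOpen_lt (hFc k) (hFc j)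
  have hbdd := isBounded_of_euclNorm_le hR
  have hx₀K := mem_connectedComponentIn hx₀
  have hfr := disjoint_frontier_connectedComponentIn hopen x₀
  set K := connectedComponentIn Cj x₀
  obtain ⟨ε, hε, hgap⟩ : ∃ ε > 0, ∀ k, k ≠ j → F x₀ k + 4 * ε < F x₀ j := by
    have hev : ∀ᶠ ε : ℝ in nhdsWithin 0 (Set.Ioi 0), ∀ k, k ≠ j → F x₀ k + 4 * ε < F x₀ j := by
      refine Filter.eventually_all.2 fun k => Filter.eventually_imp_distrib_left.2 fun hk => ?_
      have hc : Continuous fun ε : ℝ => F x₀ k + 4 * ε := by fun_prop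
      refine (hc.tendsto 0).mono_left nhdsWithin_le_nhds |>.eventually_lt_const ?_
      rw [hCj] at hx₀
      simpa using hx₀ k hk
    obtain ⟨ε, h1, h2⟩ := (hev.and self_mem_nhdsWithin).exists
    exact ⟨ε, h2, h1⟩
  have hnhds : ∀ᶠ f' in nhds G, ∀ x ∈ closure K, dist (G x) (f' x) < ε := by
    have := ContinuousMap.tendsto_iff_forall_isCompact_tendstoUniformlyOn.1
      (Filter.tendsto_id (x := nhds G)) _ hbdd.isCompact_closure
    exact Metric.tendstoUniformlyOn_iff.1 this ε hε
  obtain ⟨_, hclose, h, rfl⟩ := mem_closure_iff_nhds.1 hG _ hnhds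
  have happ : ∀ x ∈ closure K, ∀ i,
      |F x i - h x (Fin.castLE (hd (L + 1) le_rfl) i)| < ε := fun x hx i => by
    rw [hGF]
    exact (dist_le_pi_dist _ _ _).trans_lt (hclose x hx)
  obtain ⟨z, hz, t, ht, hzt⟩ := exists_frontier_add_single h
    (Fin.castLE (hd (L + 1) le_rfl) j) hbdd hx₀K
  refine Set.disjoint_left.1 hfr hz ?_
  rw [hCj]
  intro k hk
  have hkj : Fin.castLE (hd (L + 1) le_rfl) k ≠ Fin.castLE (hd (L + 1) le_rfl) j :=
    (Fin.castLE_injective _).ne hk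
  have hzj := congrFun hzt (Fin.castLE (hd (L + 1) le_rfl) j)
  have hzk := congrFun hzt (Fin.castLE (hd (L + 1) le_rfl) k)
  simp only [Pi.add_apply, Pi.single_eq_same, Pi.single_eq_of_ne hkj] at hzj hzk
  have h1 := abs_lt.1 (happ z hz.1 j)
  have h2 := abs_lt.1 (happ z hz.1 k)
  have h3 := abs_lt.1 (happ x₀ (subset_closure hx₀K) j)
  have h4 := abs_lt.1 (happ x₀ (subset_closure hx₀K) k)
  linarith [hgap k hk, h1.1, h1.2, h2.1, h2.2, h3.1, h3.2, h4.1, h4.2]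
end

section
/- Let $\sigma: \mathbb{R} \to \mathbb{R}$ be either continuous and strictly monotonic, or the ReLU activation $t \mapsto \max\{t,0\}$. Let $F: \mathbb{R}^{d_{in}} \to \mathbb{R}^{d_{out}}$ be a neural network function with activation $\sigma$ and width $\omega_F \le d_{in}$, let $j \in \{1, \dots, d_{out}\}$, let $C$ be a connected component of the decision region $C_j$, and let $K = [a,b]^{d_{in}}$ with $a < b$ be a box such that $C \cap K^{\circ} \neq \emptyset$. Then $C \cap \partial K \neq \emptyset$, i.e. every connected component of a decision region that meets the interior of a bounding box of the input data must intersect the boundary of that box. -/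
open Topology Filter

theorem StrictMono.isOpenMap_of_continuous {f : ℝ → ℝ} (hf : StrictMono f) (hc : Continuous f) :
    IsOpenMap f := by
  refine IsOpenMap.of_nhds_le fun x s hs => ?_
  obtain ⟨ε, hε, hsub⟩ := Metric.nhds_basis_closedBall.mem_iff.1 hs
  rw [Real.closedBall_eq_Icc] at hsub
  have hivt := intermediate_value_Icc (by linarith : x - ε ≤ x + ε) hc.continuousOn
  refine mem_of_superset (Icc_mem_nhds (hf (sub_lt_self x hε)) (hf (lt_add_of_pos_right x hε)))
    fun y hy => ?_
  obtain ⟨z, hz, rfl⟩ := hivt hy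
  exact hsub hz

theorem StrictAnti.isOpenMap_of_continuous {f : ℝ → ℝ} (hf : StrictAnti f) (hc : Continuous f) :
    IsOpenMap f := by
  have h := (Homeomorph.neg ℝ).isOpenMap.comp (hf.neg.isOpenMap_of_continuous hc.neg)
  have hfun : (⇑(Homeomorph.neg ℝ) ∘ fun x => -f x) = f := by
    funext x
    simp
  rwa [hfun] at h

/-- The continuous self-maps of `X` that are limits of open maps in the compact-open topology. -/
def openMapClosure (X : Type*) [TopologicalSpace X] : Set C(X, X) :=
  closure {f | IsOpenMap f}

theorem id_mem_openMapClosure (X : Type*) [TopologicalSpace X] :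
    ContinuousMap.id X ∈ openMapClosure X :=
  subset_closure IsOpenMap.id

theorem comp_mem_openMapClosure {X : Type*} [TopologicalSpace X] [LocallyCompactSpace X]
    {g f : C(X, X)} (hg : g ∈ openMapClosure X) (hf : f ∈ openMapClosure X) :
    g.comp f ∈ openMapClosure X :=
  map_mem_closure₂ (f := fun (g f : C(X, X)) => g.comp f)
    (ContinuousMap.continuous_comp'.comp continuous_swap) hg hf
    fun g hg f hf => show IsOpenMap (g ∘ f) from IsOpenMap.comp hg hf

theorem mem_openMapClosure_of_homotopy {X : Type*} [TopologicalSpace X] {f : ℝ × X → X}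
    (hf : Continuous f) {s : Set ℝ} {t₀ : ℝ} [(𝓝[s] t₀).NeBot]
    (hopen : ∀ᶠ t in 𝓝[s] t₀, IsOpenMap fun x => f (t, x))
    {g : C(X, X)} (hg : ∀ x, g x = f (t₀, x)) : g ∈ openMapClosure X := by
  let H : ℝ → C(X, X) := fun t => ⟨fun x => f (t, x), by fun_prop⟩
  have hH : Continuous H := ContinuousMap.continuous_of_continuous_uncurry _ hf
  have hg' : g = H t₀ := by
    ext x
    exact hg x
  rw [hg']
  exact mem_closure_of_tendsto (hH.continuousWithinAt (s := s)) hopen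

theorem affine_mem_openMapClosure {ι : Type*} [Fintype ι] [DecidableEq ι]
    (A : Matrix ι ι ℝ) (v : ι → ℝ) :
    (⟨fun x => A.mulVec x + v, by fun_prop⟩ : C(ι → ℝ, ι → ℝ)) ∈ openMapClosure (ι → ℝ) := by
  refine mem_openMapClosure_of_homotopy (f := fun p => (Matrix.scalar ι p.1 + A).mulVec p.2 + v)
    (s := {0}ᶜ) (t₀ := 0) ?_ ?_ ?_
  · have : (fun p : ℝ × (ι → ℝ) => (Matrix.scalar ι p.1 + A).mulVec p.2 + v) =
        fun p => p.1 • p.2 + A.mulVec p.2 + v := by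
      funext p
      rw [Matrix.add_mulVec, Matrix.scalar_apply, ← Matrix.smul_one_eq_diagonal,
        Matrix.smul_mulVec, Matrix.one_mulVec]
    rw [this]
    fun_prop
  · have hfin : {t : ℝ | (-A).charpoly.IsRoot t}.Finite :=
      Polynomial.finite_setOfPred_isRoot (-A).charpoly_monic.ne_zero
    filter_upwards [nhdsNE_le_cofinite (0 : ℝ) hfin.compl_mem_cofinite] with t ht
    have hdet : (Matrix.scalar ι t + A).det ≠ 0 := by
      simpa [Polynomial.IsRoot, Matrix.eval_charpoly] using ht
    have hsurj : Function.Surjective (Matrix.mulVecLin (Matrix.scalar ι t + A)) := by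
      refine Matrix.mulVec_surjective_iff_isUnit.2 ?_
      exact (Matrix.isUnit_iff_isUnit_det _).2 hdet.isUnit
    have h := (Homeomorph.addRight v).isOpenMap.comp
      (LinearMap.isOpenMap_of_finiteDimensional _ hsurj)
    exact h
  · intro x
    simp

theorem piMap_mem_openMapClosure {ι : Type*} [Finite ι] {σ : ℝ → ℝ} (hc : Continuous σ)
    (hσ : (StrictMono σ ∨ StrictAnti σ) ∨ ∀ t, σ t = max t 0) :
    (⟨fun x i => σ (x i), by fun_prop⟩ : C(ι → ℝ, ι → ℝ)) ∈ openMapClosure (ι → ℝ) := by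
  have hpi {τ : ℝ → ℝ} (h : IsOpenMap τ) : IsOpenMap fun (x : ι → ℝ) i => τ (x i) :=
    IsOpenMap.piMap (fun _ => h) (by simp)
  rcases hσ with hσ | hσ
  · refine subset_closure (hpi ?_)
    exact hσ.elim (·.isOpenMap_of_continuous hc) (·.isOpenMap_of_continuous hc)
  · refine mem_openMapClosure_of_homotopy (f := fun (p : ℝ × (ι → ℝ)) i => max (p.2 i) (p.1 * p.2 i))
      (s := Set.Ioi 0) (t₀ := 0) (by fun_prop) ?_ fun x => by simp [hσ]
    filter_upwards [Ioo_mem_nhdsGT (zero_lt_one' ℝ)] with t ht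
    refine hpi (τ := fun u => max u (t * u))
      (StrictMono.isOpenMap_of_continuous (fun u w huw => ?_) (by fun_prop))
    exact max_lt_max huw (mul_lt_mul_of_pos_left huw ht.1)

/-- A maximum principle for locally uniform limits of open maps: a bounded open set on whose
boundary coordinate `j` is always dominated by another one in `s` has no point where `j` strictly
dominates all of them. -/
theorem exists_le_of_mem_openMapClosure {ι : Type*} [Fintype ι] {F : C(ι → ℝ, ι → ℝ)}
    (hF : F ∈ openMapClosure (ι → ℝ)) {Ω : Set (ι → ℝ)} (hΩ : IsOpen Ω)
    (hcomp : IsCompact (closure Ω)) (j : ι) {s : Set ι} (hj : j ∉ s)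
    (hbd : ∀ x ∈ closure Ω, x ∉ Ω → ∃ k ∈ s, F x j ≤ F x k) {p : ι → ℝ} (hp : p ∈ Ω) :
    ∃ k ∈ s, F p j ≤ F p k := by
  by_contra! hlt
  obtain ⟨δ, hδlt, hδ⟩ : ∃ δ, (∀ k ∈ s, F p k + 4 * δ < F p j) ∧ 0 < δ := by
    have hev : ∀ᶠ δ in 𝓝[>] (0 : ℝ), ∀ k, k ∈ s → F p k + 4 * δ < F p j := by
      refine eventually_all.2 fun k => ?_
      by_cases hk : k ∈ s
      · have hcont : ContinuousAt (fun δ : ℝ => F p k + 4 * δ) 0 := by fun_prop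
        have h0 : F p k + 4 * (0 : ℝ) < F p j := by simpa using hlt k hk
        filter_upwards [nhdsWithin_le_nhds (hcont.eventually_lt_const h0)] with δ hδ _ using hδ
      · simp [hk]
    exact (hev.and self_mem_nhdsWithin).exists
  have hunif : ∀ᶠ f in 𝓝 F, ∀ x ∈ closure Ω, dist (F x) (f x) < δ :=
    Metric.tendstoUniformlyOn_iff.1
      (ContinuousMap.tendsto_iff_forall_isCompact_tendstoUniformlyOn.1 tendsto_id _ hcomp) δ hδ
  obtain ⟨f, hopen, hclose⟩ := ((mem_closure_iff_frequently.1 hF).and_eventually hunif).exists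
  have hcoord (x) (hx : x ∈ closure Ω) (i : ι) : |F x i - f x i| < δ :=
    (dist_le_pi_dist (F x) (f x) i).trans_lt (hclose x hx)
  have hclosed : IsClosed {x | ∀ k ∈ s, f x k + 2 * δ ≤ f x j} := by
    simp only [Set.ofPred_forall]
    exact isClosed_biInter fun k _ => isClosed_le (by fun_prop) (by fun_prop)
  obtain ⟨x, ⟨hxΩ, hx⟩, hmax⟩ := (hcomp.inter_right hclosed).exists_isMaxOn
    ⟨p, subset_closure hp, fun k hk => by
      have h1 := abs_lt.1 (hcoord p (subset_closure hp) k)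
      have h2 := abs_lt.1 (hcoord p (subset_closure hp) j)
      linarith [hδlt k hk]⟩
    (f := fun x => f x j) (by fun_prop)
  have hxmem : x ∈ Ω := by
    by_contra hxn
    obtain ⟨k, hk, hle⟩ := hbd x hxΩ hxn
    have h1 := abs_lt.1 (hcoord x hxΩ k)
    have h2 := abs_lt.1 (hcoord x hxΩ j)
    linarith [hx k hk]
  classical
  have himg : f '' Ω ∈ 𝓝 (f x) := (hopen Ω hΩ).mem_nhds ⟨x, hxmem, rfl⟩
  have hpath : Tendsto (fun t : ℝ => f x + t • Pi.single j (1 : ℝ)) (𝓝[>] 0) (𝓝 (f x)) := by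
    have hcont : Continuous fun t : ℝ => f x + t • Pi.single j (1 : ℝ) := by fun_prop
    simpa using (hcont.tendsto 0).mono_left nhdsWithin_le_nhds
  obtain ⟨t, ⟨y, hyΩ, hy⟩, ht⟩ := ((hpath.eventually himg).and self_mem_nhdsWithin).exists
  have ht : 0 < t := ht
  have hyj : f y j = f x j + t := by simp [hy]
  have hyk (k) (hk : k ∈ s) : f y k = f x k := by
    have hkj : k ≠ j := fun h => hj (h ▸ hk)
    simp [hy, hkj]
  have hle : f y j ≤ f x j := hmax ⟨subset_closure hyΩ, fun k hk => by
    rw [hyj, hyk k hk]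
    linarith [hx k hk]⟩
  linarith

theorem Matrix.exists_mulVec_extend {m n ι : Type*} [Fintype m] [Fintype ι]
    {e : m → ι} {f : n → ι} (he : Function.Injective e) (hf : Function.Injective f)
    (W : Matrix n m ℝ) : ∃ A : Matrix ι ι ℝ, ∀ y i, A.mulVec y (f i) = W.mulVec (y ∘ e) i := by
  refine ⟨fun r => Function.extend f (fun i => Function.extend e (W i) 0) 0 r, fun y i => ?_⟩
  simp only [Matrix.mulVec, dotProduct, hf.extend_apply]
  symm
  refine Fintype.sum_of_injective e he _ _ (fun k hk => ?_) fun k => ?_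
  · rw [Function.extend_apply' _ _ _ (by simpa using hk)]
    simp
  · simp [he.extend_apply]

theorem exists_affine_mem_openMapClosure {m n ι : Type*} [Fintype m] [Fintype ι]
    {e : m → ι} {f : n → ι} (he : Function.Injective e) (hf : Function.Injective f)
    (W : Matrix n m ℝ) (b : n → ℝ) :
    ∃ T ∈ openMapClosure (ι → ℝ), ∀ y i, T y (f i) = W.mulVec (y ∘ e) i + b i := by
  classical
  obtain ⟨A, hA⟩ := Matrix.exists_mulVec_extend he hf W
  exact ⟨_, affine_mem_openMapClosure A (Function.extend f b 0), fun y i => by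
    simp [hA, hf.extend_apply]⟩

theorem exists_hiddenStack_mem_openMapClosure {σ : ℝ → ℝ} (hc : Continuous σ)
    (hσ : (StrictMono σ ∨ StrictAnti σ) ∨ ∀ t, σ t = max t 0) (d : ℕ → ℕ)
    (W : (j : ℕ) → Matrix (Fin (d (j + 1))) (Fin (d j)) ℝ)
    (b : (j : ℕ) → Fin (d (j + 1)) → ℝ) (L : ℕ) (hd : ∀ j ≤ L, d j ≤ d 0) :
    ∃ H ∈ openMapClosure (Fin (d 0) → ℝ),
      ∀ x, H x ∘ Fin.castLE (hd L le_rfl) = hiddenStack σ d W b L x := by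
  induction L with
  | zero => exact ⟨_, id_mem_openMapClosure _, fun x => rfl⟩
  | succ L ih =>
    obtain ⟨H, hH, hHx⟩ := ih fun j hj => hd j (hj.trans L.le_succ)
    obtain ⟨T, hT, hTx⟩ := exists_affine_mem_openMapClosure
      (Fin.castLE_injective (hd L L.le_succ)) (Fin.castLE_injective (hd (L + 1) le_rfl))
      (W L) (b L)
    refine ⟨_, comp_mem_openMapClosure (piMap_mem_openMapClosure hc hσ)
      (comp_mem_openMapClosure hT hH), fun x => ?_⟩
    funext i
    simp [hTx, hHx, hiddenStack]

theorem notMem_of_mem_closure_connectedComponentIn {X : Type*} [TopologicalSpace X]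
    [LocallyConnectedSpace X] {U : Set X} (hU : IsOpen U) {x₀ x : X}
    (hx : x ∈ closure (connectedComponentIn U x₀)) (hx' : x ∉ connectedComponentIn U x₀) :
    x ∉ U := by
  intro hxU
  obtain ⟨y, hy, hy₀⟩ := mem_closure_iff.1 hx _ (hU.connectedComponentIn (x := x))
    (mem_connectedComponentIn hxU)
  rw [connectedComponentIn_eq hy₀, ← connectedComponentIn_eq hy] at hx'
  exact hx' (mem_connectedComponentIn hxU)

/-- For a network `F(x) = W_L(A_{L-1} ∘ ⋯ ∘ A_1(x)) + b_L` of depth `L+1` with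
activation `σ` either continuous and strictly monotonic or ReLU, and width at
most the input dimension `d 0`: every connected component of a decision region
`C_j = {x : F_j(x) > F_k(x) ∀ k ≠ j}` that meets the interior of a box
`K = [a,b]^{d 0}` (`a < b`) also meets the boundary `∂K` of the box. -/
theorem decision_region_component_meets_box_boundary
    (σ : ℝ → ℝ)
    (hσ : (Continuous σ ∧ (StrictMono σ ∨ StrictAnti σ)) ∨ (∀ t, σ t = max t 0))
    (d : ℕ → ℕ) (L : ℕ)
    (W : (j : ℕ) → Matrix (Fin (d (j + 1))) (Fin (d j)) ℝ)
    (b : (j : ℕ) → Fin (d (j + 1)) → ℝ)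
    (hwidth : ∀ j, 1 ≤ j → j ≤ L + 1 → d j ≤ d 0)
    (F : (Fin (d 0) → ℝ) → Fin (d (L + 1)) → ℝ)
    (hF : ∀ x, F x = (W L).mulVec (hiddenStack σ d W b L x) + b L)
    (j : Fin (d (L + 1)))
    (Cj : Set (Fin (d 0) → ℝ))
    (hCj : Cj = {x | ∀ k, k ≠ j → F x k < F x j})
    (x₀ : Fin (d 0) → ℝ) (hx₀ : x₀ ∈ Cj)
    (a c : ℝ) (hac : a < c)
    (K : Set (Fin (d 0) → ℝ)) (hK : K = {x | ∀ i, x i ∈ Set.Icc a c})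
    (hmeet : (connectedComponentIn Cj x₀ ∩ interior K).Nonempty) :
    (connectedComponentIn Cj x₀ ∩ frontier K).Nonempty := by
  have hc : Continuous σ := by
    rcases hσ with h | h
    · exact h.1
    · rw [funext h]
      fun_prop
  have hd (i : ℕ) (hi : i ≤ L + 1) : d i ≤ d 0 := by
    rcases Nat.eq_zero_or_pos i with rfl | hpos
    · exact le_rfl
    · exact hwidth i hpos hi
  obtain ⟨H, hH, hHx⟩ := exists_hiddenStack_mem_openMapClosure hc (hσ.imp_left (·.2)) d W b L
    fun i hi => hd i (hi.trans L.le_succ)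
  let e : Fin (d (L + 1)) → Fin (d 0) := Fin.castLE (hd (L + 1) le_rfl)
  have he : Function.Injective e := Fin.castLE_injective _
  obtain ⟨T, hT, hTx⟩ := exists_affine_mem_openMapClosure
    (Fin.castLE_injective (hd L L.le_succ)) he (W L) (b L)
  have hG (x i) : T.comp H x (e i) = F x i := by
    simp [hTx, hHx, hF]
  have hFc (i) : Continuous fun x => F x i := by
    simp only [← hG]
    fun_prop
  have hopen : IsOpen Cj := by
    simp only [hCj, Set.ofPred_forall]
    exact isOpen_iInter_of_finite fun k => isOpen_iInter_of_finite fun _ =>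
      isOpen_lt (hFc k) (hFc j)
  have hKc : IsCompact K := by
    have : K = Set.univ.pi fun _ => Set.Icc a c := by
      ext x
      simp only [hK, Set.mem_univ_pi, Set.mem_ofPred_eq]
    rw [this]
    exact isCompact_univ_pi fun _ => isCompact_Icc
  by_contra hempty
  rw [Set.not_nonempty_iff_eq_empty] at hempty
  set C := connectedComponentIn Cj x₀ with hCdef
  have hCK : C ⊆ K := by
    refine (isPreconnected_connectedComponentIn.subset_left_of_subset_union isOpen_interior
      hKc.isClosed.isOpen_compl (disjoint_compl_right.mono_left interior_subset)
      (fun x hx => ?_) hmeet).trans interior_subset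
    by_contra hxn
    simp only [Set.mem_union, Set.mem_compl_iff, not_or, not_not] at hxn
    exact Set.eq_empty_iff_forall_notMem.1 hempty x ⟨hx, subset_closure hxn.2, hxn.1⟩
  have hCcomp : IsCompact (closure C) :=
    hKc.of_isClosed_subset isClosed_closure (closure_minimal hCK hKc.isClosed)
  obtain ⟨_, ⟨k, hk, rfl⟩, hle⟩ := exists_le_of_mem_openMapClosure
    (comp_mem_openMapClosure hT hH) hopen.connectedComponentIn hCcomp (e j) (s := e '' {j}ᶜ)
    (by simp [he.eq_iff])
    (fun x hx hx' => by
      have hxn := notMem_of_mem_closure_connectedComponentIn hopen hx hx'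
      simp only [hCj, Set.mem_ofPred_eq, not_forall, not_lt] at hxn
      obtain ⟨k, hk, hle⟩ := hxn
      exact ⟨e k, ⟨k, hk, rfl⟩, by simpa only [hG] using hle⟩)
    (mem_connectedComponentIn hx₀)
  rw [hG, hG] at hle
  rw [hCj] at hx₀
  exact (hx₀ k hk).not_ge hle
end
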